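/- For t, τ, X complex with 0 < Im t < Im τ and exp(2πi(X+mτ)) ≠ 1 for all integers m, the Fourier coefficients of Θ_{X;t}(z) = (i/2π) θ₁'(0;τ)θ₁(z+X+t;τ)/(θ₁(X;τ)θ₁(z+t;τ)) on [-1/2,1/2] are given by ∫_{-1/2}^{1/2} Θ_{X;t}(z) e^{-2πi m z} dz = exp(2πi m t)/(1 - exp(2πi(X+mτ))) for all m ∈ ℤ. -/

import Mathlib

open Complex Real BigOperators

/-- The Jacobi theta function `θ₁(z;τ)`. -/
noncomputable def jacobiTheta₁ (z τ : ℂ) : ℂ :=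
  -Complex.I * ∑' k : ℤ, (-1 : ℂ) ^ k *
    Complex.exp ((π : ℂ) * Complex.I * τ * ((k : ℂ) + 1 / 2) ^ 2) *
    Complex.exp (2 * (π : ℂ) * Complex.I * ((k : ℂ) + 1 / 2) * z)

/-- The derivative of `θ₁` with respect to `z`. -/
noncomputable def jacobiTheta₁' (z τ : ℂ) : ℂ :=
  deriv (fun w => jacobiTheta₁ w τ) z

/-- The coefficients of the series defining `θ₁`. -/
noncomputable def thetaCoeff (τ : ℂ) (k : ℤ) : ℂ :=
  (-1 : ℂ) ^ k * Complex.exp ((π : ℂ) * Complex.I * τ * ((k : ℂ) + 1 / 2) ^ 2)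

/-- The coefficient `(1 - e^{2πi(X+mτ)})⁻¹` of the Lerch-type series. -/
noncomputable def lerchCoeff (τ X : ℂ) (m : ℤ) : ℂ :=
  (1 - Complex.exp (2 * (π : ℂ) * Complex.I * (X + (m : ℂ) * τ)))⁻¹

lemma thetaCoeff_ne_zero (τ : ℂ) (k : ℤ) : thetaCoeff τ k ≠ 0 :=
  mul_ne_zero (zpow_ne_zero _ (by norm_num)) (Complex.exp_ne_zero _)

lemma thetaCoeff_add_one (τ : ℂ) (k : ℤ) :
    thetaCoeff τ (k + 1) =
      -Complex.exp (2 * (π : ℂ) * Complex.I * (((k : ℂ) + 1) * τ)) * thetaCoeff τ k := by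
  unfold thetaCoeff
  rw [zpow_add_one₀ (by norm_num)]
  have : Complex.exp ((π : ℂ) * Complex.I * τ * (((k + 1 : ℤ) : ℂ) + 1 / 2) ^ 2) =
      Complex.exp (2 * (π : ℂ) * Complex.I * (((k : ℂ) + 1) * τ)) *
        Complex.exp ((π : ℂ) * Complex.I * τ * ((k : ℂ) + 1 / 2) ^ 2) := by
    rw [← Complex.exp_add]
    congr 1
    push_cast
    ring
  rw [this]
  ring

lemma thetaCoeff_reflect (τ : ℂ) (k : ℤ) : thetaCoeff τ (-1 - k) = -thetaCoeff τ k := by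
  unfold thetaCoeff
  have h : ((-1 : ℂ)) ^ (-1 - k) = -(-1) ^ k := by
    rw [zpow_sub₀ (by norm_num), zpow_neg_one]
    rcases Int.even_or_odd k with hk | hk
    · simp [hk.neg_one_zpow]
    · simp [hk.neg_one_zpow]
  rw [h]
  push_cast
  ring_nf

lemma theta_term_eq (τ z : ℂ) (k : ℤ) :
    thetaCoeff τ k * Complex.exp (2 * (π : ℂ) * Complex.I * ((k : ℂ) + 1 / 2) * z) =
      Complex.exp ((π : ℂ) * Complex.I * (z + τ / 4)) *
        jacobiTheta₂_term k (z + τ / 2 + 1 / 2) τ := by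
  have h : ((-1 : ℂ)) ^ k = Complex.exp ((k : ℂ) * ((π : ℂ) * Complex.I)) := by
    rw [Complex.exp_int_mul, Complex.exp_pi_mul_I]
  unfold thetaCoeff jacobiTheta₂_term
  rw [h, ← Complex.exp_add, ← Complex.exp_add, ← Complex.exp_add]
  congr 1
  ring

lemma summable_norm_theta_term {τ : ℂ} (hτ : 0 < τ.im) (z : ℂ) :
    Summable fun k : ℤ =>
      ‖thetaCoeff τ k * Complex.exp (2 * (π : ℂ) * Complex.I * ((k : ℂ) + 1 / 2) * z)‖ := by
  simp_rw [theta_term_eq]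
  exact (((summable_jacobiTheta₂_term_iff _ _).2 hτ).mul_left _).norm

lemma jacobiTheta₁_eq_tsum (z τ : ℂ) :
    jacobiTheta₁ z τ = -Complex.I * ∑' k : ℤ,
      thetaCoeff τ k * Complex.exp (2 * (π : ℂ) * Complex.I * ((k : ℂ) + 1 / 2) * z) := rfl

lemma jacobiTheta₁_eq_jacobiTheta₂ (z τ : ℂ) :
    jacobiTheta₁ z τ = -Complex.I * (Complex.exp ((π : ℂ) * Complex.I * (z + τ / 4)) *
        jacobiTheta₂ (z + τ / 2 + 1 / 2) τ) := by
  simp_rw [jacobiTheta₁_eq_tsum, jacobiTheta₂, theta_term_eq, tsum_mul_left]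

lemma differentiable_jacobiTheta₁ {τ : ℂ} (hτ : 0 < τ.im) :
    Differentiable ℂ fun z => jacobiTheta₁ z τ := by
  simp_rw [jacobiTheta₁_eq_jacobiTheta₂]
  intro z
  have h := (differentiableAt_jacobiTheta₂_fst (z + τ / 2 + 1 / 2) hτ).comp z
    (f := fun z => z + τ / 2 + 1 / 2) (by fun_prop)
  have h2 : DifferentiableAt ℂ (fun z => Complex.exp ((π : ℂ) * Complex.I * (z + τ / 4))) z := by
    fun_prop
  exact (h2.mul h).const_mul _

lemma summable_thetaCoeff {τ : ℂ} (hτ : 0 < τ.im) : Summable fun k => ‖thetaCoeff τ k‖ := by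
  simpa using summable_norm_theta_term hτ 0

lemma tsum_thetaCoeff (τ : ℂ) : ∑' k, thetaCoeff τ k = 0 := by
  have h := (Equiv.subLeft (-1 : ℤ)).tsum_eq (thetaCoeff τ)
  simp only [Equiv.subLeft_apply, thetaCoeff_reflect, tsum_neg] at h
  exact self_eq_neg.mp h.symm

lemma jacobiTheta₁_zero (τ : ℂ) : jacobiTheta₁ 0 τ = 0 := by
  simp [jacobiTheta₁_eq_tsum, tsum_thetaCoeff]

/-- A function given by an absolutely convergent Fourier series has the expected coefficients. -/
lemma integral_tsum_fourier {f : ℤ → ℂ} (hf : Summable fun n => ‖f n‖) (m : ℤ) :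
    (∫ z in (-(1 / 2) : ℝ)..(1 / 2 : ℝ),
      (∑' n : ℤ, f n * Complex.exp (2 * (π : ℂ) * Complex.I * (n : ℂ) * (z : ℂ))) *
        Complex.exp (-2 * (π : ℂ) * Complex.I * (m : ℂ) * (z : ℂ))) = f m := by
  have hn : ∀ (n : ℤ) (z : ℝ), ‖f n * Complex.exp (2 * (π : ℂ) * Complex.I * (n : ℂ) * (z : ℂ)) *
      Complex.exp (-2 * (π : ℂ) * Complex.I * (m : ℂ) * (z : ℂ))‖ = ‖f n‖ := by
    intro n z
    rw [norm_mul, norm_mul, Complex.norm_exp, Complex.norm_exp]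
    simp
  have h := intervalIntegral.hasSum_integral_of_dominated_convergence
    (μ := MeasureTheory.volume) (a := (-(1 / 2) : ℝ)) (b := (1 / 2 : ℝ))
    (F := fun (n : ℤ) (z : ℝ) => f n * Complex.exp (2 * (π : ℂ) * Complex.I * (n : ℂ) * (z : ℂ)) *
      Complex.exp (-2 * (π : ℂ) * Complex.I * (m : ℂ) * (z : ℂ)))
    (f := fun z : ℝ => (∑' n : ℤ,
        f n * Complex.exp (2 * (π : ℂ) * Complex.I * (n : ℂ) * (z : ℂ))) *
        Complex.exp (-2 * (π : ℂ) * Complex.I * (m : ℂ) * (z : ℂ)))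
    (bound := fun n _ => ‖f n‖)
    (fun n => (by fun_prop : Continuous _).aestronglyMeasurable)
    (fun n => Filter.Eventually.of_forall fun z _ => (hn n z).le)
    (Filter.Eventually.of_forall fun z _ => hf)
    (by simp)
    (Filter.Eventually.of_forall fun z _ => by
      refine HasSum.mul_right _ (Summable.hasSum (Summable.of_norm ?_))
      refine hf.congr fun n => ?_
      rw [norm_mul, Complex.norm_exp]
      simp)
  have hs : ∀ n : ℤ, (∫ z in (-(1 / 2) : ℝ)..(1 / 2 : ℝ),
      f n * Complex.exp (2 * (π : ℂ) * Complex.I * (n : ℂ) * (z : ℂ)) *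
      Complex.exp (-2 * (π : ℂ) * Complex.I * (m : ℂ) * (z : ℂ))) = if n = m then f m else 0 := by
    intro n
    split_ifs with hnm
    · subst hnm
      have : ∀ z : ℝ, f n * Complex.exp (2 * (π : ℂ) * Complex.I * (n : ℂ) * (z : ℂ)) *
          Complex.exp (-2 * (π : ℂ) * Complex.I * (n : ℂ) * (z : ℂ)) = f n := by
        intro z
        rw [mul_assoc, ← Complex.exp_add]
        ring_nf
        simp
      simp_rw [this]
      norm_num
    · have hc : 2 * (π : ℂ) * Complex.I * ((n - m : ℤ) : ℂ) ≠ 0 :=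
        mul_ne_zero Complex.two_pi_I_ne_zero (Int.cast_ne_zero.2 (sub_ne_zero.2 hnm))
      have : ∀ z : ℝ, f n * Complex.exp (2 * (π : ℂ) * Complex.I * (n : ℂ) * (z : ℂ)) *
          Complex.exp (-2 * (π : ℂ) * Complex.I * (m : ℂ) * (z : ℂ)) =
          f n * Complex.exp (2 * (π : ℂ) * Complex.I * ((n - m : ℤ) : ℂ) * (z : ℂ)) := by
        intro z
        rw [mul_assoc, ← Complex.exp_add]
        push_cast
        ring_nf
      simp_rw [this]
      rw [intervalIntegral.integral_const_mul, integral_exp_mul_complex hc]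
      have hp : Complex.exp (2 * (π : ℂ) * Complex.I * ((n - m : ℤ) : ℂ) * ((1 / 2 : ℝ) : ℂ)) =
          Complex.exp (2 * (π : ℂ) * Complex.I * ((n - m : ℤ) : ℂ) * ((-(1 / 2) : ℝ) : ℂ)) := by
        rw [Complex.exp_eq_exp_iff_exists_int]
        refine ⟨n - m, ?_⟩
        push_cast
        ring
      rw [hp]
      simp
  simp_rw [hs] at h
  exact h.unique (hasSum_ite_eq m (f m))

lemma exists_norm_inv_one_sub_le {q v : ℂ} (hq : ‖q‖ < 1) :
    ∃ K, ∀ n : ℕ, ‖(1 - v * q ^ n)⁻¹‖ ≤ K := by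
  have h1 : Filter.Tendsto (fun n : ℕ => (1 - v * q ^ n)⁻¹) Filter.atTop (nhds (1 - v * 0)⁻¹) :=
    ((tendsto_const_nhds.sub ((tendsto_pow_atTop_nhds_zero_of_norm_lt_one hq).const_mul v)).inv₀
      (by simp))
  obtain ⟨K, hK⟩ := h1.norm.bddAbove_range
  exact ⟨K, fun n => hK ⟨n, rfl⟩⟩

lemma lerchCoeff_eq (τ X : ℂ) (m : ℤ) : lerchCoeff τ X m =
    (1 - Complex.exp (2 * (π : ℂ) * Complex.I * X) *
      Complex.exp (2 * (π : ℂ) * Complex.I * τ) ^ m)⁻¹ := by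
  rw [lerchCoeff, ← Complex.exp_int_mul, ← Complex.exp_add]
  ring_nf

lemma norm_exp_two_pi_I_mul (z : ℂ) :
    ‖Complex.exp (2 * (π : ℂ) * Complex.I * z)‖ = Real.exp (-(2 * π * z.im)) := by
  rw [Complex.norm_exp]
  simp

lemma exists_norm_lerchCoeff_sub_le {τ X : ℂ} (hτ : 0 < τ.im)
    (hX : ∀ m : ℤ, Complex.exp (2 * (π : ℂ) * Complex.I * (X + (m : ℂ) * τ)) ≠ 1) :
    ∃ K, 0 ≤ K ∧ ∀ m : ℤ, ‖lerchCoeff τ X m - if 0 ≤ m then 1 else 0‖ ≤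
      K * ‖Complex.exp (2 * (π : ℂ) * Complex.I * τ)‖ ^ m.natAbs := by
  have hX' : ∀ m : ℤ, Complex.exp (2 * (π : ℂ) * Complex.I * X) *
      Complex.exp (2 * (π : ℂ) * Complex.I * τ) ^ m ≠ 1 := by
    intro m
    convert hX m using 1
    rw [← Complex.exp_int_mul, ← Complex.exp_add]
    ring_nf
  simp_rw [lerchCoeff_eq]
  have hq : ‖Complex.exp (2 * (π : ℂ) * Complex.I * τ)‖ < 1 := by
    rw [norm_exp_two_pi_I_mul, Real.exp_lt_one_iff]
    have := Real.pi_pos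
    have : 0 < 2 * π * τ.im := by positivity
    linarith
  have hq0 := Complex.exp_ne_zero (2 * (π : ℂ) * Complex.I * τ)
  have hw0 := Complex.exp_ne_zero (2 * (π : ℂ) * Complex.I * X)
  set q := Complex.exp (2 * (π : ℂ) * Complex.I * τ)
  set w := Complex.exp (2 * (π : ℂ) * Complex.I * X)
  obtain ⟨K₁, h₁⟩ := exists_norm_inv_one_sub_le (v := w) hq
  obtain ⟨K₂, h₂⟩ := exists_norm_inv_one_sub_le (v := w⁻¹) hq
  have p₁ : 0 ≤ K₁ := (norm_nonneg _).trans (h₁ 0)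
  have p₂ : 0 ≤ K₂ := (norm_nonneg _).trans (h₂ 0)
  refine ⟨‖w‖ * K₁ + ‖w⁻¹‖ * K₂, by positivity, fun m => ?_⟩
  rcases le_or_gt 0 m with hm | hm
  · obtain ⟨n, rfl⟩ := Int.eq_ofNat_of_zero_le hm
    have hne : 1 - w * q ^ n ≠ 0 := sub_ne_zero.2 (by simpa using (hX' n).symm)
    have : (1 - w * q ^ n)⁻¹ - 1 = w * (1 - w * q ^ n)⁻¹ * q ^ n := by
      field_simp
      ring
    simp only [zpow_natCast, Int.natCast_nonneg, if_true, Int.natAbs_natCast]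
    rw [this, norm_mul, norm_mul, norm_pow]
    gcongr
    have := mul_le_mul_of_nonneg_left (h₁ n) (norm_nonneg w)
    have : 0 ≤ ‖w⁻¹‖ * K₂ := by positivity
    linarith
  · obtain ⟨n, rfl⟩ : ∃ n : ℕ, m = -(n : ℤ) := ⟨m.natAbs, by omega⟩
    have hne : 1 - w * (q ^ n)⁻¹ ≠ 0 := sub_ne_zero.2 (by simpa using (hX' (-n)).symm)
    have hqn := pow_ne_zero n hq0
    have hne' : 1 - w⁻¹ * q ^ n ≠ 0 := by
      intro h
      apply hne
      field_simp at h ⊢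
      linear_combination -h
    have : (1 - w * (q ^ n)⁻¹)⁻¹ = -(w⁻¹ * (1 - w⁻¹ * q ^ n)⁻¹ * q ^ n) := by
      rw [inv_eq_iff_eq_inv, inv_neg, mul_inv, mul_inv, inv_inv, inv_inv]
      field_simp
      ring
    simp only [zpow_neg, zpow_natCast, not_le.2 hm, if_false, Int.natAbs_neg, Int.natAbs_natCast,
      sub_zero]
    rw [this, norm_neg, norm_mul, norm_mul, norm_pow]
    gcongr
    have := mul_le_mul_of_nonneg_left (h₂ n) (norm_nonneg w⁻¹)
    have : 0 ≤ ‖w‖ * K₁ := by positivity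
    linarith

lemma summable_pow_natAbs {r : ℝ} (h0 : 0 ≤ r) (h1 : r < 1) :
    Summable fun m : ℤ => r ^ m.natAbs :=
  Summable.of_nat_of_neg (by simpa using summable_geometric_of_lt_one h0 h1)
    (by simpa using summable_geometric_of_lt_one h0 h1)

lemma hasSum_int_geometric {x : ℂ} (hx : ‖x‖ < 1) :
    HasSum (fun m : ℤ => (if 0 ≤ m then 1 else 0) * x ^ m) (1 - x)⁻¹ := by
  rw [← Function.Injective.hasSum_iff (Nat.cast_injective (R := ℤ))]
  · simpa [Function.comp_def] using hasSum_geometric_of_norm_lt_one hx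
  · intro m hm
    have : ¬ 0 ≤ m := fun h => hm ⟨m.toNat, by simpa using h⟩
    simp [this]

/-- The Lerch-type series converges on an annulus, where it differs from the
geometric series by a bounded amount. -/
lemma lerch_series_bound {τ X : ℂ} (hτ : 0 < τ.im)
    (hX : ∀ m : ℤ, Complex.exp (2 * (π : ℂ) * Complex.I * (X + (m : ℂ) * τ)) ≠ 1)
    {ρ : ℝ} (hρ : ‖Complex.exp (2 * (π : ℂ) * Complex.I * τ)‖ < ρ) :
    ∃ M, ∀ x : ℂ, ρ ≤ ‖x‖ → ‖x‖ < 1 →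
      (Summable fun m : ℤ => ‖lerchCoeff τ X m * x ^ m‖) ∧
      ‖(∑' m : ℤ, lerchCoeff τ X m * x ^ m) - (1 - x)⁻¹‖ ≤ M := by
  obtain ⟨K, hK0, hK⟩ := exists_norm_lerchCoeff_sub_le hτ hX
  set q := Complex.exp (2 * (π : ℂ) * Complex.I * τ)
  have hρ0 : 0 < ρ := (norm_nonneg q).trans_lt hρ
  have hs : Summable fun m : ℤ => K * (‖q‖ / ρ) ^ m.natAbs :=
    (summable_pow_natAbs (by positivity) ((div_lt_one hρ0).2 hρ)).mul_left K
  refine ⟨∑' m : ℤ, K * (‖q‖ / ρ) ^ m.natAbs, fun x hx hx1 => ?_⟩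
  have hx0 : 0 < ‖x‖ := hρ0.trans_le hx
  have hb : ∀ m : ℤ, ‖(lerchCoeff τ X m - if 0 ≤ m then 1 else 0) * x ^ m‖ ≤
      K * (‖q‖ / ρ) ^ m.natAbs := by
    intro m
    have hxm : ‖x‖ ^ m ≤ (ρ⁻¹) ^ m.natAbs := by
      rcases le_or_gt 0 m with hm | hm
      · obtain ⟨n, rfl⟩ := Int.eq_ofNat_of_zero_le hm
        rw [zpow_natCast, Int.natAbs_natCast]
        exact (pow_le_one₀ hx0.le hx1.le).trans
          (one_le_pow₀ ((one_le_inv₀ hρ0).2 (hx.trans hx1.le)))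
      · obtain ⟨n, rfl⟩ : ∃ n : ℕ, m = -(n : ℤ) := ⟨m.natAbs, by omega⟩
        rw [zpow_neg, zpow_natCast, Int.natAbs_neg, Int.natAbs_natCast, ← inv_pow]
        gcongr
    rw [norm_mul, norm_zpow, div_eq_mul_inv, mul_pow, ← mul_assoc]
    exact mul_le_mul (hK m) hxm (by positivity) (by positivity)
  have hs1 := Summable.of_nonneg_of_le (fun _ => norm_nonneg _) hb hs
  have hg := hasSum_int_geometric hx1
  have hsum : HasSum (fun m : ℤ => lerchCoeff τ X m * x ^ m)
      ((∑' m : ℤ, (lerchCoeff τ X m - if 0 ≤ m then 1 else 0) * x ^ m) + (1 - x)⁻¹) := by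
    refine (hs1.of_norm.hasSum.add hg).congr_fun ?_
    intro m
    ring
  refine ⟨hsum.summable.norm, ?_⟩
  rw [hsum.tsum_eq, add_sub_cancel_right]
  exact tsum_of_norm_bounded hs.hasSum hb

lemma exists_norm_lerchCoeff_le {τ X : ℂ} (hτ : 0 < τ.im)
    (hX : ∀ m : ℤ, Complex.exp (2 * (π : ℂ) * Complex.I * (X + (m : ℂ) * τ)) ≠ 1) :
    ∃ K, ∀ m : ℤ, ‖lerchCoeff τ X m‖ ≤ K := by
  obtain ⟨K, hK0, hK⟩ := exists_norm_lerchCoeff_sub_le hτ hX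
  refine ⟨K + 1, fun m => ?_⟩
  have hq : ‖Complex.exp (2 * (π : ℂ) * Complex.I * τ)‖ ≤ 1 := by
    rw [norm_exp_two_pi_I_mul, Real.exp_le_one_iff]
    have := Real.pi_pos
    have : 0 < 2 * π * τ.im := by positivity
    linarith
  have h1 : ‖lerchCoeff τ X m - if 0 ≤ m then 1 else 0‖ ≤ K :=
    (hK m).trans (mul_le_of_le_one_right hK0 (pow_le_one₀ (norm_nonneg _) hq))
  have h2 : ‖(if 0 ≤ m then 1 else 0 : ℂ)‖ ≤ 1 := by split_ifs <;> simp
  calc ‖lerchCoeff τ X m‖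
      = ‖(lerchCoeff τ X m - if 0 ≤ m then 1 else 0) + if 0 ≤ m then 1 else 0‖ := by
        rw [sub_add_cancel]
    _ ≤ K + 1 := (norm_add_le _ _).trans (add_le_add h1 h2)

/-- The convolution of the coefficients of `θ₁` with those of the Lerch-type series. -/
noncomputable def thetaLerchConv (τ X : ℂ) (n : ℤ) : ℂ :=
  ∑' k : ℤ, thetaCoeff τ k * lerchCoeff τ X (n - k)

lemma thetaLerchConv_add_one {τ X : ℂ} (hτ : 0 < τ.im)
    (hX : ∀ m : ℤ, Complex.exp (2 * (π : ℂ) * Complex.I * (X + (m : ℂ) * τ)) ≠ 1) (n : ℤ) :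
    thetaLerchConv τ X (n + 1) =
      -Complex.exp (2 * (π : ℂ) * Complex.I * (X + ((n : ℂ) + 1) * τ)) *
        thetaLerchConv τ X n := by
  obtain ⟨K, hK⟩ := exists_norm_lerchCoeff_le hτ hX
  have hs : ∀ n : ℤ, Summable fun k => thetaCoeff τ k * lerchCoeff τ X (n - k) := by
    intro n
    refine Summable.of_norm_bounded ((summable_thetaCoeff hτ).mul_right K) fun k => ?_
    rw [norm_mul]
    exact mul_le_mul_of_nonneg_left (hK _) (norm_nonneg _)
  have key : ∀ k : ℤ, thetaCoeff τ (k + 1) * lerchCoeff τ X (n + 1 - (k + 1)) =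
      -Complex.exp (2 * (π : ℂ) * Complex.I * (X + ((n : ℂ) + 1) * τ)) *
        (thetaCoeff τ k * lerchCoeff τ X (n - k)) + thetaCoeff τ (k + 1) := by
    intro k
    have hne := sub_ne_zero.2 (hX (n - k)).symm
    have he : Complex.exp (2 * (π : ℂ) * Complex.I * (X + ((n : ℂ) + 1) * τ)) =
        Complex.exp (2 * (π : ℂ) * Complex.I * (((k : ℂ) + 1) * τ)) *
          Complex.exp (2 * (π : ℂ) * Complex.I * (X + ((n - k : ℤ) : ℂ) * τ)) := by
      rw [← Complex.exp_add]
      congr 1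
      push_cast
      ring
    rw [add_sub_add_right_eq_sub, thetaCoeff_add_one, he, lerchCoeff]
    generalize Complex.exp (2 * (π : ℂ) * Complex.I * (X + ((n - k : ℤ) : ℂ) * τ)) = y at hne
    field_simp
    ring
  have h1 := (Equiv.addRight (1 : ℤ)).tsum_eq
    (fun k => thetaCoeff τ k * lerchCoeff τ X (n + 1 - k))
  have h2 := (Equiv.addRight (1 : ℤ)).tsum_eq (thetaCoeff τ)
  have hs2 := (Equiv.addRight (1 : ℤ)).summable_iff.2 (summable_thetaCoeff hτ).of_norm
  simp only [Equiv.coe_addRight] at h1 h2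
  simp only [Function.comp_def, Equiv.coe_addRight] at hs2
  rw [thetaLerchConv, ← h1]
  simp_rw [key]
  rw [((hs n).mul_left _).tsum_add hs2, h2, tsum_thetaCoeff, add_zero, tsum_mul_left,
    thetaLerchConv]

lemma exists_thetaLerchConv_eq {τ X : ℂ} (hτ : 0 < τ.im)
    (hX : ∀ m : ℤ, Complex.exp (2 * (π : ℂ) * Complex.I * (X + (m : ℂ) * τ)) ≠ 1) :
    ∃ C, ∀ n : ℤ, thetaLerchConv τ X n = C *
      (thetaCoeff τ n * Complex.exp (2 * (π : ℂ) * Complex.I * ((n : ℂ) + 1 / 2) * X)) := by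
  set r : ℤ → ℂ := fun n =>
    thetaCoeff τ n * Complex.exp (2 * (π : ℂ) * Complex.I * ((n : ℂ) + 1 / 2) * X) with hr
  have hr0 : ∀ n, r n ≠ 0 := fun n =>
    mul_ne_zero (thetaCoeff_ne_zero τ n) (Complex.exp_ne_zero _)
  have hr1 : ∀ n : ℤ, r (n + 1) =
      -Complex.exp (2 * (π : ℂ) * Complex.I * (X + ((n : ℂ) + 1) * τ)) * r n := by
    intro n
    have h1 : Complex.exp (2 * (π : ℂ) * Complex.I * (((n + 1 : ℤ) : ℂ) + 1 / 2) * X) =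
        Complex.exp (2 * (π : ℂ) * Complex.I * X) *
          Complex.exp (2 * (π : ℂ) * Complex.I * ((n : ℂ) + 1 / 2) * X) := by
      rw [← Complex.exp_add]
      congr 1
      push_cast
      ring
    have h2 : Complex.exp (2 * (π : ℂ) * Complex.I * (X + ((n : ℂ) + 1) * τ)) =
        Complex.exp (2 * (π : ℂ) * Complex.I * X) *
          Complex.exp (2 * (π : ℂ) * Complex.I * (((n : ℂ) + 1) * τ)) := by
      rw [← Complex.exp_add]
      congr 1
      ring
    simp only [hr]
    rw [h1, h2, thetaCoeff_add_one]
    ring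
  have hstep : ∀ n : ℤ, thetaLerchConv τ X (n + 1) / r (n + 1) = thetaLerchConv τ X n / r n := by
    intro n
    rw [thetaLerchConv_add_one hτ hX, hr1,
      mul_div_mul_left _ _ (neg_ne_zero.2 (Complex.exp_ne_zero _))]
  refine ⟨thetaLerchConv τ X 0 / r 0, fun n => ?_⟩
  change _ = _ * r n
  rw [← div_eq_iff (hr0 n)]
  induction n using Int.induction_on with
  | zero => rfl
  | succ n ih => rw [hstep, ih]
  | pred n ih => rw [← ih, ← hstep, sub_add_cancel]

lemma exp_two_pi_I_mul_zpow (z : ℂ) (m : ℤ) :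
    Complex.exp (2 * (π : ℂ) * Complex.I * z) ^ m =
      Complex.exp (2 * (π : ℂ) * Complex.I * (m : ℂ) * z) := by
  rw [← Complex.exp_int_mul]
  ring_nf

lemma norm_exp_two_pi_I_mul_lt {z w : ℂ} (h : z.im < w.im) :
    ‖Complex.exp (2 * (π : ℂ) * Complex.I * w)‖ < ‖Complex.exp (2 * (π : ℂ) * Complex.I * z)‖ := by
  rw [norm_exp_two_pi_I_mul, norm_exp_two_pi_I_mul, Real.exp_lt_exp, neg_lt_neg_iff]
  exact mul_lt_mul_of_pos_left h (by positivity)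

lemma norm_exp_two_pi_I_mul_lt_one {z : ℂ} (h : 0 < z.im) :
    ‖Complex.exp (2 * (π : ℂ) * Complex.I * z)‖ < 1 := by
  simpa using norm_exp_two_pi_I_mul_lt (z := 0) (w := z) (by simpa using h)

lemma summable_lerch_series {τ X z : ℂ} (hz : 0 < z.im) (hzτ : z.im < τ.im)
    (hX : ∀ m : ℤ, Complex.exp (2 * (π : ℂ) * Complex.I * (X + (m : ℂ) * τ)) ≠ 1) :
    Summable fun m : ℤ =>
      ‖lerchCoeff τ X m * Complex.exp (2 * (π : ℂ) * Complex.I * (m : ℂ) * z)‖ := by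
  obtain ⟨M, hM⟩ := lerch_series_bound (hz.trans hzτ) hX (norm_exp_two_pi_I_mul_lt hzτ)
  simpa only [exp_two_pi_I_mul_zpow] using (hM _ le_rfl (norm_exp_two_pi_I_mul_lt_one hz)).1

/-- On the strip `0 < Im z < Im τ`, the Lerch-type series times `θ₁(z)` is a constant multiple
of `θ₁(z + X)`. -/
lemma exists_lerch_series_mul_theta {τ X : ℂ} (hτ : 0 < τ.im)
    (hX : ∀ m : ℤ, Complex.exp (2 * (π : ℂ) * Complex.I * (X + (m : ℂ) * τ)) ≠ 1) :
    ∃ C, ∀ z : ℂ, 0 < z.im → z.im < τ.im →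
      (∑' m : ℤ, lerchCoeff τ X m * Complex.exp (2 * (π : ℂ) * Complex.I * (m : ℂ) * z)) *
        jacobiTheta₁ z τ = C * jacobiTheta₁ (z + X) τ := by
  obtain ⟨C, hC⟩ := exists_thetaLerchConv_eq hτ hX
  refine ⟨C, fun z hz hzτ => ?_⟩
  have hS := summable_lerch_series hz hzτ hX
  have hT := summable_norm_theta_term hτ z
  have hP := (summable_mul_of_summable_norm hT hS)
  let e : ℤ × ℤ ≃ ℤ × ℤ :=
    { toFun := fun p => (p.2, p.1 - p.2)
      invFun := fun p => (p.1 + p.2, p.1)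
      left_inv := fun p => by simp
      right_inv := fun p => by simp }
  have hP' := e.summable_iff.2 hP
  simp only [Function.comp_def] at hP'
  have hterm : ∀ n k : ℤ,
      thetaCoeff τ k * Complex.exp (2 * (π : ℂ) * Complex.I * ((k : ℂ) + 1 / 2) * z) *
      (lerchCoeff τ X (n - k) *
        Complex.exp (2 * (π : ℂ) * Complex.I * ((n - k : ℤ) : ℂ) * z)) =
      thetaCoeff τ k * lerchCoeff τ X (n - k) *
        Complex.exp (2 * (π : ℂ) * Complex.I * ((n : ℂ) + 1 / 2) * z) := by
    intro n k
    have : Complex.exp (2 * (π : ℂ) * Complex.I * ((n : ℂ) + 1 / 2) * z) =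
        Complex.exp (2 * (π : ℂ) * Complex.I * ((k : ℂ) + 1 / 2) * z) *
        Complex.exp (2 * (π : ℂ) * Complex.I * ((n - k : ℤ) : ℂ) * z) := by
      rw [← Complex.exp_add]
      congr 1
      push_cast
      ring
    rw [this]
    ring
  have hfin : ∀ n : ℤ, C *
      (thetaCoeff τ n * Complex.exp (2 * (π : ℂ) * Complex.I * ((n : ℂ) + 1 / 2) * X)) *
      Complex.exp (2 * (π : ℂ) * Complex.I * ((n : ℂ) + 1 / 2) * z) =
      C * (thetaCoeff τ n *
        Complex.exp (2 * (π : ℂ) * Complex.I * ((n : ℂ) + 1 / 2) * (z + X))) := by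
    intro n
    rw [mul_add _ z X, Complex.exp_add]
    ring
  rw [jacobiTheta₁_eq_tsum, jacobiTheta₁_eq_tsum, mul_comm, mul_assoc,
    tsum_mul_tsum_of_summable_norm hT hS, ← e.tsum_eq, hP'.tsum_prod]
  simp only [e, Equiv.coe_fn_mk]
  simp_rw [hterm, tsum_mul_right]
  change -Complex.I * ∑' n : ℤ, thetaLerchConv τ X n * _ = _
  simp_rw [hC, hfin, tsum_mul_left]
  ring

lemma tendsto_mul_I_nhdsGT_zero :
    Filter.Tendsto (fun s : ℝ => (s : ℂ) * Complex.I) (nhdsWithin 0 (Set.Ioi 0))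
      (nhdsWithin 0 {0}ᶜ) := by
  refine tendsto_nhdsWithin_iff.2 ⟨?_, ?_⟩
  · have : Continuous fun s : ℝ => (s : ℂ) * Complex.I := by fun_prop
    simpa using (this.tendsto 0).mono_left nhdsWithin_le_nhds
  · filter_upwards [self_mem_nhdsWithin] with s hs
    have : (s : ℂ) ≠ 0 := Complex.ofReal_ne_zero.2 (ne_of_gt hs)
    simpa using this

/-- Near `0` on the positive imaginary axis, the Lerch-type series is `(1 - e^{2πiz})⁻¹` up to a
bounded error. -/
lemma exists_lerch_series_bound_near_zero {τ X : ℂ} (hτ : 0 < τ.im)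
    (hX : ∀ m : ℤ, Complex.exp (2 * (π : ℂ) * Complex.I * (X + (m : ℂ) * τ)) ≠ 1) :
    ∃ M, ∀ᶠ s : ℝ in nhdsWithin 0 (Set.Ioi 0),
      ‖(∑' m : ℤ, lerchCoeff τ X m *
          Complex.exp (2 * (π : ℂ) * Complex.I * (m : ℂ) * ((s : ℂ) * Complex.I))) -
        (1 - Complex.exp (2 * (π : ℂ) * Complex.I * ((s : ℂ) * Complex.I)))⁻¹‖ ≤ M := by
  obtain ⟨M, hM⟩ := lerch_series_bound hτ hX
    (ρ := ‖Complex.exp (2 * (π : ℂ) * Complex.I * (τ / 2))‖)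
    (norm_exp_two_pi_I_mul_lt (by simp; linarith))
  refine ⟨M, ?_⟩
  filter_upwards [Ioo_mem_nhdsGT (half_pos hτ)] with s hs
  have h1 : ‖Complex.exp (2 * (π : ℂ) * Complex.I * ((s : ℂ) * Complex.I))‖ < 1 :=
    norm_exp_two_pi_I_mul_lt_one (by simpa using hs.1)
  have h2 := norm_exp_two_pi_I_mul_lt (z := (s : ℂ) * Complex.I) (w := τ / 2) (by simpa using hs.2)
  simpa only [exp_two_pi_I_mul_zpow] using (hM _ h2.le h1).2

lemma tendsto_slope_one_sub_exp :
    Filter.Tendsto (fun z : ℂ => (1 - Complex.exp (2 * (π : ℂ) * Complex.I * z)) / z)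
      (nhdsWithin 0 {0}ᶜ) (nhds (-(2 * (π : ℂ) * Complex.I))) := by
  have h : HasDerivAt (fun z : ℂ => 1 - Complex.exp (2 * (π : ℂ) * Complex.I * z))
      (-(2 * (π : ℂ) * Complex.I)) 0 := by
    have := (((hasDerivAt_id (0 : ℂ)).const_mul (2 * (π : ℂ) * Complex.I)).cexp).const_sub 1
    simpa using this
  refine (hasDerivAt_iff_tendsto_slope.1 h).congr fun z => ?_
  simp [slope_def_field]

lemma tendsto_slope_jacobiTheta₁ {τ : ℂ} (hτ : 0 < τ.im) :
    Filter.Tendsto (fun z : ℂ => jacobiTheta₁ z τ / z)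
      (nhdsWithin 0 {0}ᶜ) (nhds (jacobiTheta₁' 0 τ)) := by
  have h := ((differentiable_jacobiTheta₁ hτ) 0).hasDerivAt
  refine (hasDerivAt_iff_tendsto_slope.1 h).congr fun z => ?_
  simp [slope_def_field, jacobiTheta₁_zero]

/-- The residue comparison at `z = 0`. -/
lemma tendsto_lerch_series_mul_theta {τ X : ℂ} (hτ : 0 < τ.im)
    (hX : ∀ m : ℤ, Complex.exp (2 * (π : ℂ) * Complex.I * (X + (m : ℂ) * τ)) ≠ 1) :
    Filter.Tendsto (fun s : ℝ => (∑' m : ℤ, lerchCoeff τ X m *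
          Complex.exp (2 * (π : ℂ) * Complex.I * (m : ℂ) * ((s : ℂ) * Complex.I))) *
        jacobiTheta₁ ((s : ℂ) * Complex.I) τ) (nhdsWithin 0 (Set.Ioi 0))
      (nhds (Complex.I / (2 * (π : ℂ)) * jacobiTheta₁' 0 τ)) := by
  obtain ⟨M, hM⟩ := exists_lerch_series_bound_near_zero hτ hX
  have hθ : Filter.Tendsto (fun s : ℝ => jacobiTheta₁ ((s : ℂ) * Complex.I) τ)
      (nhdsWithin 0 (Set.Ioi 0)) (nhds 0) := by
    have h := ((differentiable_jacobiTheta₁ hτ).continuous.tendsto 0)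
    rw [jacobiTheta₁_zero] at h
    exact h.comp (tendsto_mul_I_nhdsGT_zero.mono_right nhdsWithin_le_nhds)
  have h1 := hθ.zero_mul_isBoundedUnder_le (Filter.isBoundedUnder_of_eventually_le hM)
  have h2 := ((tendsto_slope_jacobiTheta₁ hτ).div tendsto_slope_one_sub_exp
    (neg_ne_zero.2 Complex.two_pi_I_ne_zero)).comp tendsto_mul_I_nhdsGT_zero
  have hc : jacobiTheta₁' 0 τ / -(2 * (π : ℂ) * Complex.I) =
      Complex.I / (2 * (π : ℂ)) * jacobiTheta₁' 0 τ := by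
    have hpi : (π : ℂ) ≠ 0 := Complex.ofReal_ne_zero.2 Real.pi_ne_zero
    field_simp
    rw [Complex.I_sq]
    ring
  have h3 := h1.add h2
  rw [hc, zero_add] at h3
  refine h3.congr' ?_
  filter_upwards [self_mem_nhdsWithin] with s hs
  have hs0 : (s : ℂ) ≠ 0 := Complex.ofReal_ne_zero.2 (ne_of_gt hs)
  simp only [Function.comp_apply, Pi.div_apply]
  rw [div_div_div_cancel_right₀ (mul_ne_zero hs0 Complex.I_ne_zero)]
  ring

lemma eventually_lerch_series_ne_zero {τ X : ℂ} (hτ : 0 < τ.im)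
    (hX : ∀ m : ℤ, Complex.exp (2 * (π : ℂ) * Complex.I * (X + (m : ℂ) * τ)) ≠ 1) :
    ∀ᶠ s : ℝ in nhdsWithin 0 (Set.Ioi 0), (∑' m : ℤ, lerchCoeff τ X m *
      Complex.exp (2 * (π : ℂ) * Complex.I * (m : ℂ) * ((s : ℂ) * Complex.I))) ≠ 0 := by
  obtain ⟨M, hM⟩ := exists_lerch_series_bound_near_zero hτ hX
  have hx : Filter.Tendsto
      (fun s : ℝ => 1 - Complex.exp (2 * (π : ℂ) * Complex.I * ((s : ℂ) * Complex.I)))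
      (nhdsWithin 0 (Set.Ioi 0)) (nhds 0) := by
    have : Continuous fun s : ℝ =>
        1 - Complex.exp (2 * (π : ℂ) * Complex.I * ((s : ℂ) * Complex.I)) := by fun_prop
    simpa using (this.tendsto 0).mono_left nhdsWithin_le_nhds
  have h1 := (hx.zero_mul_isBoundedUnder_le
    (Filter.isBoundedUnder_of_eventually_le hM)).add_const 1
  rw [zero_add] at h1
  filter_upwards [h1.eventually_ne one_ne_zero, self_mem_nhdsWithin] with s hs hpos h0
  rw [h0] at hs
  have hlt : ‖Complex.exp (2 * (π : ℂ) * Complex.I * ((s : ℂ) * Complex.I))‖ < 1 :=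
    norm_exp_two_pi_I_mul_lt_one (by simpa using hpos)
  have hne : 1 - Complex.exp (2 * (π : ℂ) * Complex.I * ((s : ℂ) * Complex.I)) ≠ 0 := by
    intro h
    rw [← sub_eq_zero.1 h] at hlt
    simp at hlt
  apply hs
  rw [zero_sub, mul_neg, mul_inv_cancel₀ hne, neg_add_cancel]

lemma exp_ne_one_of_strip {τ z : ℂ} (hz : 0 < z.im) (hzτ : z.im < τ.im) (m : ℤ) :
    Complex.exp (2 * (π : ℂ) * Complex.I * (z + (m : ℂ) * τ)) ≠ 1 := by
  intro h
  have h1 := norm_exp_two_pi_I_mul (z + (m : ℂ) * τ)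
  rw [h, norm_one, eq_comm, Real.exp_eq_one_iff] at h1
  have h2 : z.im + m * τ.im = 0 := by
    have := Real.pi_pos
    have h3 : π * (z + (m : ℂ) * τ).im = 0 := by linarith
    simpa [this.ne'] using h3
  rcases le_or_gt 0 m with hm | hm
  · have : (0 : ℝ) ≤ m := by exact_mod_cast hm
    nlinarith
  · have : (m : ℝ) ≤ -1 := by exact_mod_cast (by omega : m ≤ -1)
    nlinarith

/-- `θ₁` does not vanish identically on any horizontal line. -/
lemma exists_jacobiTheta₁_ne_zero {τ : ℂ} (hτ : 0 < τ.im) (y : ℝ) :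
    ∃ x : ℝ, jacobiTheta₁ (x + y * Complex.I) τ ≠ 0 := by
  by_contra! h
  have hterm : ∀ (k : ℤ) (x : ℝ), thetaCoeff τ k *
      Complex.exp (2 * (π : ℂ) * Complex.I * ((k : ℂ) + 1 / 2) * (x + y * Complex.I)) =
      Complex.exp ((π : ℂ) * Complex.I * x) * (thetaCoeff τ k *
        Complex.exp (2 * (π : ℂ) * Complex.I * ((k : ℂ) + 1 / 2) * (y * Complex.I)) *
      Complex.exp (2 * (π : ℂ) * Complex.I * (k : ℂ) * (x : ℂ))) := by
    intro k x
    have : Complex.exp (2 * (π : ℂ) * Complex.I * ((k : ℂ) + 1 / 2) * (x + y * Complex.I)) =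
        Complex.exp ((π : ℂ) * Complex.I * x) *
        Complex.exp (2 * (π : ℂ) * Complex.I * ((k : ℂ) + 1 / 2) * (y * Complex.I)) *
        Complex.exp (2 * (π : ℂ) * Complex.I * (k : ℂ) * (x : ℂ)) := by
      rw [← Complex.exp_add, ← Complex.exp_add]
      congr 1
      ring
    rw [this]
    ring
  have h0 : ∀ x : ℝ, (∑' k : ℤ, thetaCoeff τ k *
        Complex.exp (2 * (π : ℂ) * Complex.I * ((k : ℂ) + 1 / 2) * (y * Complex.I)) *
      Complex.exp (2 * (π : ℂ) * Complex.I * (k : ℂ) * (x : ℂ))) = 0 := by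
    intro x
    have := h x
    rw [jacobiTheta₁_eq_tsum] at this
    simp_rw [hterm, tsum_mul_left] at this
    simpa using this
  have hi := integral_tsum_fourier (summable_norm_theta_term hτ (y * Complex.I)) 0
  simp_rw [h0] at hi
  simp only [zero_mul, intervalIntegral.integral_zero] at hi
  exact mul_ne_zero (thetaCoeff_ne_zero τ 0) (Complex.exp_ne_zero _) hi.symm

/-- The Kronecker-type identity: the Lerch-type series times `θ₁(z)` equals `C θ₁(z + X)`, where
`C θ₁(X) = (i/2π) θ₁'(0)`; moreover `C ≠ 0`. -/
lemma kronecker_identity {τ X : ℂ} (hτ : 0 < τ.im)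
    (hX : ∀ m : ℤ, Complex.exp (2 * (π : ℂ) * Complex.I * (X + (m : ℂ) * τ)) ≠ 1) :
    ∃ C, C ≠ 0 ∧ C * jacobiTheta₁ X τ = Complex.I / (2 * (π : ℂ)) * jacobiTheta₁' 0 τ ∧
      ∀ z : ℂ, 0 < z.im → z.im < τ.im →
      (∑' m : ℤ, lerchCoeff τ X m * Complex.exp (2 * (π : ℂ) * Complex.I * (m : ℂ) * z)) *
        jacobiTheta₁ z τ = C * jacobiTheta₁ (z + X) τ := by
  obtain ⟨C, hC⟩ := exists_lerch_series_mul_theta hτ hX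
  have hev : ∀ᶠ s : ℝ in nhdsWithin 0 (Set.Ioi 0),
      (∑' m : ℤ, lerchCoeff τ X m *
          Complex.exp (2 * (π : ℂ) * Complex.I * (m : ℂ) * ((s : ℂ) * Complex.I))) *
        jacobiTheta₁ ((s : ℂ) * Complex.I) τ = C * jacobiTheta₁ ((s : ℂ) * Complex.I + X) τ := by
    filter_upwards [Ioo_mem_nhdsGT hτ] with s hs
    exact hC _ (by simpa using hs.1) (by simpa using hs.2)
  refine ⟨C, ?_, ?_, hC⟩
  · rintro rfl
    have hz : ∀ᶠ s : ℝ in nhdsWithin 0 (Set.Ioi 0),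
        jacobiTheta₁ ((s : ℂ) * Complex.I) τ = 0 := by
      filter_upwards [hev, eventually_lerch_series_ne_zero hτ hX] with s h1 h2
      rw [zero_mul] at h1
      exact (mul_eq_zero.1 h1).resolve_left h2
    have han : AnalyticOnNhd ℂ (fun z => jacobiTheta₁ z τ) Set.univ :=
      (differentiable_jacobiTheta₁ hτ).differentiableOn.analyticOnNhd isOpen_univ
    have hzero := han.eqOn_zero_of_preconnected_of_frequently_eq_zero isPreconnected_univ
      (Set.mem_univ 0) (tendsto_mul_I_nhdsGT_zero.frequently hz.frequently)
    obtain ⟨x, hx⟩ := exists_jacobiTheta₁_ne_zero hτ 0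
    exact hx (hzero (Set.mem_univ _))
  · have hcont := (differentiable_jacobiTheta₁ hτ).continuous
    have hlim : Filter.Tendsto (fun s : ℝ => C * jacobiTheta₁ ((s : ℂ) * Complex.I + X) τ)
        (nhdsWithin 0 (Set.Ioi 0)) (nhds (C * jacobiTheta₁ X τ)) := by
      have : Continuous fun s : ℝ => C * jacobiTheta₁ ((s : ℂ) * Complex.I + X) τ :=
        continuous_const.mul (hcont.comp (g := fun z => jacobiTheta₁ z τ)
          (by fun_prop : Continuous fun s : ℝ => (s : ℂ) * Complex.I + X))
      simpa using (this.tendsto 0).mono_left nhdsWithin_le_nhds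
    exact tendsto_nhds_unique hlim ((tendsto_lerch_series_mul_theta hτ hX).congr' hev)

lemma jacobiTheta₁'_zero_ne_zero {τ : ℂ} (hτ : 0 < τ.im) : jacobiTheta₁' 0 τ ≠ 0 := by
  obtain ⟨x, hx⟩ := exists_jacobiTheta₁_ne_zero hτ (τ.im / 2)
  obtain ⟨C, hC0, hC, -⟩ := kronecker_identity hτ
    (exp_ne_one_of_strip (τ := τ) (z := x + (τ.im / 2 : ℝ) * Complex.I)
      (by simpa using half_pos hτ) (by simpa using half_lt_self hτ))
  intro h
  rw [h, mul_zero] at hC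
  exact mul_ne_zero hC0 hx hC

lemma jacobiTheta₁_ne_zero {τ X : ℂ} (hτ : 0 < τ.im)
    (hX : ∀ m : ℤ, Complex.exp (2 * (π : ℂ) * Complex.I * (X + (m : ℂ) * τ)) ≠ 1) :
    jacobiTheta₁ X τ ≠ 0 := by
  obtain ⟨C, -, hC, -⟩ := kronecker_identity hτ hX
  intro h
  rw [h, mul_zero] at hC
  have hpi : (π : ℂ) ≠ 0 := Complex.ofReal_ne_zero.2 Real.pi_ne_zero
  exact mul_ne_zero (div_ne_zero Complex.I_ne_zero (mul_ne_zero two_ne_zero hpi))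
    (jacobiTheta₁'_zero_ne_zero hτ) hC.symm

/-- Fourier coefficients of `Θ_{X;t}(z) = (i/2π) θ₁'(0)θ₁(z+X+t)/(θ₁(X)θ₁(z+t))`. -/
theorem fourier_coefficients_Theta_X_t (t τ X : ℂ) (ht : 0 < t.im) (htτ : t.im < τ.im)
    (hX : ∀ m : ℤ, Complex.exp (2 * (π : ℂ) * Complex.I * (X + (m : ℂ) * τ)) ≠ 1)
    (m : ℤ) :
    (∫ z in (-(1 / 2) : ℝ)..(1 / 2 : ℝ),
        (Complex.I / (2 * (π : ℂ))) *
          (jacobiTheta₁' 0 τ * jacobiTheta₁ ((z : ℂ) + X + t) τ /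
            (jacobiTheta₁ X τ * jacobiTheta₁ ((z : ℂ) + t) τ)) *
          Complex.exp (-2 * (π : ℂ) * Complex.I * (m : ℂ) * (z : ℂ)))
      = Complex.exp (2 * (π : ℂ) * Complex.I * (m : ℂ) * t) /
          (1 - Complex.exp (2 * (π : ℂ) * Complex.I * (X + (m : ℂ) * τ))) := by
  have hτ : 0 < τ.im := ht.trans htτ
  obtain ⟨C, -, hC, hid⟩ := kronecker_identity hτ hX
  have hθX := jacobiTheta₁_ne_zero hτ hX
  have hint : ∀ z : ℝ, (Complex.I / (2 * (π : ℂ))) *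
      (jacobiTheta₁' 0 τ * jacobiTheta₁ ((z : ℂ) + X + t) τ /
        (jacobiTheta₁ X τ * jacobiTheta₁ ((z : ℂ) + t) τ)) =
      ∑' n : ℤ, lerchCoeff τ X n * Complex.exp (2 * (π : ℂ) * Complex.I * (n : ℂ) * t) *
        Complex.exp (2 * (π : ℂ) * Complex.I * (n : ℂ) * (z : ℂ)) := by
    intro z
    have h1 : 0 < ((z : ℂ) + t).im := by simpa using ht
    have h2 : ((z : ℂ) + t).im < τ.im := by simpa using htτ
    have hθz := jacobiTheta₁_ne_zero hτ (exp_ne_one_of_strip h1 h2)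
    have hS : ∑' n : ℤ, lerchCoeff τ X n *
        Complex.exp (2 * (π : ℂ) * Complex.I * (n : ℂ) * t) *
        Complex.exp (2 * (π : ℂ) * Complex.I * (n : ℂ) * (z : ℂ)) =
        ∑' n : ℤ, lerchCoeff τ X n *
          Complex.exp (2 * (π : ℂ) * Complex.I * (n : ℂ) * ((z : ℂ) + t)) := by
      refine tsum_congr fun n => ?_
      rw [mul_assoc, ← Complex.exp_add]
      ring_nf
    rw [hS, eq_div_of_mul_eq hθz (hid _ h1 h2), add_right_comm, mul_div_assoc', ← mul_assoc, ← hC]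
    field_simp
  simp_rw [hint]
  rw [integral_tsum_fourier (summable_lerch_series ht htτ hX), lerchCoeff, div_eq_inv_mul]
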